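/- Let u : ℝ³×[0,∞) → ℝ³, ρ, p : ℝ³×[0,∞) → ℝ, F : ℝ³×[0,∞) → ℝ³ be smooth, with ρ everywhere positive, satisfying the Euler equation ρ(∂_t u + (u·∇)u) = −∇p + ρF on ℝ³×(0,∞). Then the expansion rate φ = ∇·u satisfies on ℝ³×(0,∞): ∂_t φ = −(u·∇)φ − ∇(1/ρ)·∇p + |ω|² − Σ_{i,j}(∂_j u^i)² − (1/ρ)Δp + ∇·F, where ω = ∇∧u is the vorticity. -/

import Mathlib

noncomputable section

/-- Spatial partial derivative in the `j`-th coordinate direction. -/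
def pd (j : Fin 3) (f : (Fin 3 → ℝ) → ℝ) (x : Fin 3 → ℝ) : ℝ :=
  fderiv ℝ f x (Pi.single j 1)

/-- The Levi-Civita symbol on `Fin 3`. -/
def eps (i j k : Fin 3) : ℝ :=
  (((j : ℕ) : ℝ) - ((i : ℕ) : ℝ)) * (((k : ℕ) : ℝ) - ((i : ℕ) : ℝ)) *
    (((k : ℕ) : ℝ) - ((j : ℕ) : ℝ)) / 2

/-- The vorticity `ω(x,t) = ∇∧u(x,t)` of a time-dependent velocity field,
`ω^i = Σ_{j,k} ε^{ijk} ∂_j u^k`. -/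
def vort (u : (Fin 3 → ℝ) → ℝ → Fin 3 → ℝ) (x : Fin 3 → ℝ) (t : ℝ) (i : Fin 3) : ℝ :=
  ∑ j, ∑ k, eps i j k * pd j (fun y => u y t k) x

/-- The expansion rate `φ(x,t) = ∇·u(x,t)` of a time-dependent velocity field. -/
def expR (u : (Fin 3 → ℝ) → ℝ → Fin 3 → ℝ) (x : Fin 3 → ℝ) (t : ℝ) : ℝ :=
  ∑ i, pd i (fun y => u y t i) x

lemma pd_add' {j : Fin 3} {f g : (Fin 3 → ℝ) → ℝ} (hf : Differentiable ℝ f) (hg : Differentiable ℝ g)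
    (x : Fin 3 → ℝ) : pd j (fun y => f y + g y) x = pd j f x + pd j g x := by
  unfold pd
  rw [fderiv_fun_add (hf x) (hg x)]; rfl

lemma pd_sub' {j : Fin 3} {f g : (Fin 3 → ℝ) → ℝ} (hf : Differentiable ℝ f) (hg : Differentiable ℝ g)
    (x : Fin 3 → ℝ) : pd j (fun y => f y - g y) x = pd j f x - pd j g x := by
  unfold pd
  rw [fderiv_fun_sub (hf x) (hg x)]; rfl

lemma pd_mul' {j : Fin 3} {f g : (Fin 3 → ℝ) → ℝ} (hf : Differentiable ℝ f) (hg : Differentiable ℝ g)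
    (x : Fin 3 → ℝ) : pd j (fun y => f y * g y) x = f x * pd j g x + g x * pd j f x := by
  unfold pd
  rw [fderiv_fun_mul (hf x) (hg x)]; rfl

lemma pd_sum' {j : Fin 3} {f : Fin 3 → (Fin 3 → ℝ) → ℝ} (hf : ∀ i, Differentiable ℝ (f i))
    (x : Fin 3 → ℝ) : pd j (fun y => ∑ i, f i y) x = ∑ i, pd j (f i) x := by
  unfold pd
  rw [fderiv_fun_sum (fun i _ => hf i x)]; simp

lemma contDiff_pd {j : Fin 3} {f : (Fin 3 → ℝ) → ℝ} (hf : ContDiff ℝ (⊤ : ℕ∞) f) :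
    ContDiff ℝ (⊤ : ℕ∞) (pd j f) := by
  unfold pd
  exact (hf.fderiv_right (m := (⊤ : ℕ∞)) (by norm_cast)).clm_apply contDiff_const

lemma second_deriv {V : Type*} [NormedAddCommGroup V] [NormedSpace ℝ V] {f : V → ℝ} {x : V}
    (hf : ContDiffAt ℝ (⊤ : ℕ∞) f x) (v w : V) :
    fderiv ℝ (fun y => fderiv ℝ f y v) x w = fderiv ℝ (fun y => fderiv ℝ f y w) x v := by
  have hd : DifferentiableAt ℝ (fderiv ℝ f) x :=
    (hf.fderiv_right (m := (⊤ : ℕ∞)) (by norm_cast)).differentiableAt (by simp)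
  have hs : IsSymmSndFDerivAt ℝ f x := hf.isSymmSndFDerivAt (by
    simp only [minSmoothness_of_isRCLikeNormedField]; exact WithTop.coe_le_coe.2 (le_top : (2 : ℕ∞) ≤ ⊤))
  rw [fderiv_clm_apply hd (differentiableAt_const v), fderiv_clm_apply hd (differentiableAt_const w)]
  simp
  exact hs w v

lemma pd_comm' {i j : Fin 3} {f : (Fin 3 → ℝ) → ℝ} (hf : ContDiff ℝ (⊤ : ℕ∞) f) (x : Fin 3 → ℝ) :
    pd i (pd j f) x = pd j (pd i f) x :=
  second_deriv hf.contDiffAt _ _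

lemma pd_slice {j : Fin 3} {G : (Fin 3 → ℝ) × ℝ → ℝ} {x : Fin 3 → ℝ} {t : ℝ}
    (hG : DifferentiableAt ℝ G (x, t)) :
    pd j (fun y => G (y, t)) x = fderiv ℝ G (x, t) (Pi.single j 1, 0) := by
  have h := hG.hasFDerivAt.comp x (hasFDerivAt_prodMk_left (𝕜 := ℝ) x t)
  unfold pd
  have h2 := h.fderiv
  rw [show (fun y => G (y, t)) = G ∘ (fun y => (y, t)) from rfl, h2]
  simp

lemma deriv_slice {G : (Fin 3 → ℝ) × ℝ → ℝ} {x : Fin 3 → ℝ} {t : ℝ}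
    (hG : DifferentiableAt ℝ G (x, t)) :
    deriv (fun s => G (x, s)) t = fderiv ℝ G (x, t) (0, 1) := by
  have h := hG.hasFDerivAt.comp t (hasFDerivAt_prodMk_right (𝕜 := ℝ) x t)
  have h2 := h.hasDerivAt.deriv
  rw [show (fun s => G (x, s)) = G ∘ (fun s => (x, s)) from rfl, h2]
  simp

lemma dderiv {G : (Fin 3 → ℝ) × ℝ → ℝ} (hG : ∀ q : (Fin 3 → ℝ) × ℝ, 0 < q.2 → ContDiffAt ℝ (⊤ : ℕ∞) G q)
    (v : (Fin 3 → ℝ) × ℝ) {q : (Fin 3 → ℝ) × ℝ} (hq : 0 < q.2) :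
    DifferentiableAt ℝ (fun z => fderiv ℝ G z v) q :=
  (((hG q hq).fderiv_right (m := (⊤ : ℕ∞)) (by norm_cast)).differentiableAt (by simp)).clm_apply
    (differentiableAt_const v)

lemma swap_dt {i : Fin 3} {G : (Fin 3 → ℝ) × ℝ → ℝ}
    (hG : ∀ q : (Fin 3 → ℝ) × ℝ, 0 < q.2 → ContDiffAt ℝ (⊤ : ℕ∞) G q) (x : Fin 3 → ℝ) {t : ℝ}
    (ht : 0 < t) :
    HasDerivAt (fun s => pd i (fun y => G (y, s)) x)
      (pd i (fun y => deriv (fun s => G (y, s)) t) x) t := by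
  have hd : ∀ q : (Fin 3 → ℝ) × ℝ, 0 < q.2 → DifferentiableAt ℝ G q := fun q hq =>
    (hG q hq).differentiableAt (by simp)
  have e1 : (fun s => pd i (fun y => G (y, s)) x) =ᶠ[nhds t]
      fun s => fderiv ℝ G (x, s) (Pi.single i 1, 0) := by
    filter_upwards [lt_mem_nhds ht] with s hs
    exact pd_slice (hd (x, s) hs)
  have e2 : (fun y => deriv (fun s => G (y, s)) t) = fun y => fderiv ℝ G (y, t) (0, 1) := by
    funext y
    exact deriv_slice (hd (y, t) ht)
  have d1 : DifferentiableAt ℝ (fun s => fderiv ℝ G (x, s) (Pi.single i 1, 0)) t :=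
    DifferentiableAt.comp t (g := fun z => fderiv ℝ G z (Pi.single i 1, 0))
      (dderiv hG _ (q := (x, t)) ht)
      (hasFDerivAt_prodMk_right (𝕜 := ℝ) x t).differentiableAt
  have := (d1.hasDerivAt).congr_of_eventuallyEq e1
  refine this.congr_deriv ?_
  symm
  rw [e2, pd_slice (G := fun z => fderiv ℝ G z (0, 1)) (dderiv hG _ ht),
    deriv_slice (G := fun z => fderiv ℝ G z (Pi.single i 1, 0)) (dderiv hG _ ht)]
  exact second_deriv (hG (x, t) ht) _ _

lemma cda {H : Type*} [NormedAddCommGroup H] [NormedSpace ℝ H] {G : (Fin 3 → ℝ) × ℝ → H}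
    (hG : ContDiffOn ℝ (⊤ : ℕ∞) G {q | 0 ≤ q.2}) (q : (Fin 3 → ℝ) × ℝ) (hq : 0 < q.2) :
    ContDiffAt ℝ (⊤ : ℕ∞) G q := by
  refine hG.contDiffAt ?_
  filter_upwards [continuous_snd.continuousAt.eventually (lt_mem_nhds hq)] with z hz
  exact le_of_lt hz

lemma slice_cd {G : (Fin 3 → ℝ) × ℝ → ℝ} {t : ℝ} (ht : 0 < t)
    (hG : ∀ q : (Fin 3 → ℝ) × ℝ, 0 < q.2 → ContDiffAt ℝ (⊤ : ℕ∞) G q) :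
    ContDiff ℝ (⊤ : ℕ∞) (fun y => G (y, t)) := by
  rw [contDiff_iff_contDiffAt]
  intro y
  exact ContDiffAt.comp y (g := G) (f := fun y => (y, t)) (hG (y, t) ht)
    (contDiffAt_id.prodMk contDiffAt_const)

/-- For an inviscid flow governed by the Euler equation
`ρ(∂_t u + (u·∇)u) = −∇p + ρF`, the expansion rate satisfies
`∂_t φ = −(u·∇)φ − ∇(1/ρ)·∇p + |ω|² − |∇u|² − (1/ρ)Δp + ∇·F`. -/
theorem statement_12 (u : (Fin 3 → ℝ) → ℝ → Fin 3 → ℝ)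
    (ρ pr : (Fin 3 → ℝ) → ℝ → ℝ) (F : (Fin 3 → ℝ) → ℝ → Fin 3 → ℝ)
    (hu : ContDiffOn ℝ (⊤ : ℕ∞) (fun q : (Fin 3 → ℝ) × ℝ => u q.1 q.2) {q | 0 ≤ q.2})
    (hρ : ContDiffOn ℝ (⊤ : ℕ∞) (fun q : (Fin 3 → ℝ) × ℝ => ρ q.1 q.2) {q | 0 ≤ q.2})
    (hpr : ContDiffOn ℝ (⊤ : ℕ∞) (fun q : (Fin 3 → ℝ) × ℝ => pr q.1 q.2) {q | 0 ≤ q.2})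
    (hF : ContDiffOn ℝ (⊤ : ℕ∞) (fun q : (Fin 3 → ℝ) × ℝ => F q.1 q.2) {q | 0 ≤ q.2})
    (hpos : ∀ x t, 0 ≤ t → 0 < ρ x t)
    (heuler : ∀ (x : Fin 3 → ℝ) (t : ℝ), 0 < t → ∀ i,
      ρ x t * (deriv (fun s => u x s i) t + ∑ j, u x t j * pd j (fun y => u y t i) x)
        = -pd i (fun y => pr y t) x + ρ x t * F x t i) :
    ∀ (x : Fin 3 → ℝ) (t : ℝ), 0 < t →
      deriv (fun s => expR u x s) t
        = -(∑ j, u x t j * pd j (fun y => expR u y t) x)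
          - (∑ i, pd i (fun y => (ρ y t)⁻¹) x * pd i (fun y => pr y t) x)
          + (∑ i, (vort u x t i) ^ 2)
          - (∑ i, ∑ j, (pd j (fun y => u y t i) x) ^ 2)
          - (ρ x t)⁻¹ * (∑ i, pd i (pd i (fun y => pr y t)) x)
          + (∑ i, pd i (fun y => F y t i) x) := by
  intro x t ht
  have hU : ∀ i, ∀ q : (Fin 3 → ℝ) × ℝ, 0 < q.2 →
      ContDiffAt ℝ (⊤ : ℕ∞) (fun q : (Fin 3 → ℝ) × ℝ => u q.1 q.2 i) q := fun i q hq =>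
    contDiffAt_pi.1 (cda hu q hq) i
  have hFc : ∀ i, ∀ q : (Fin 3 → ℝ) × ℝ, 0 < q.2 →
      ContDiffAt ℝ (⊤ : ℕ∞) (fun q : (Fin 3 → ℝ) × ℝ => F q.1 q.2 i) q := fun i q hq =>
    contDiffAt_pi.1 (cda hF q hq) i
  have cu : ∀ i, ContDiff ℝ (⊤ : ℕ∞) (fun y => u y t i) := fun i => slice_cd ht (hU i)
  have cF : ∀ i, ContDiff ℝ (⊤ : ℕ∞) (fun y => F y t i) := fun i => slice_cd ht (hFc i)
  have cr : ContDiff ℝ (⊤ : ℕ∞) (fun y => ρ y t) := slice_cd ht (cda hρ)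
  have cp : ContDiff ℝ (⊤ : ℕ∞) (fun y => pr y t) := slice_cd ht (cda hpr)
  have cri : ContDiff ℝ (⊤ : ℕ∞) (fun y => (ρ y t)⁻¹) := cr.inv fun y => (hpos y t ht.le).ne'
  have dif : ∀ {f : (Fin 3 → ℝ) → ℝ}, ContDiff ℝ (⊤ : ℕ∞) f → Differentiable ℝ f :=
    fun h => h.differentiable (by simp)
  have hdt : ∀ i, (fun y => deriv (fun s => u y s i) t) = fun y =>
      F y t i - (∑ j, u y t j * pd j (fun y => u y t i) y)
        - (ρ y t)⁻¹ * pd i (fun y => pr y t) y := by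
    intro i
    funext y
    have h := heuler y t ht i
    have h0 := (hpos y t ht.le).ne'
    field_simp
    linarith
  have key : ∀ i, pd i (fun y => deriv (fun s => u y s i) t) x =
      pd i (fun y => F y t i) x - (∑ j, (u x t j * pd j (pd i (fun y => u y t i)) x
        + pd j (fun y => u y t i) x * pd i (fun y => u y t j) x))
      - ((ρ x t)⁻¹ * pd i (pd i (fun y => pr y t)) x
        + pd i (fun y => pr y t) x * pd i (fun y => (ρ y t)⁻¹) x) := by
    intro i
    have c1 : ∀ j, ContDiff ℝ (⊤ : ℕ∞) (fun y => u y t j * pd j (fun y => u y t i) y) :=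
      fun j => (cu j).mul (contDiff_pd (cu i))
    have c2 : ContDiff ℝ (⊤ : ℕ∞) (fun y => ∑ j, u y t j * pd j (fun y => u y t i) y) :=
      ContDiff.sum fun j _ => c1 j
    have c3 : ContDiff ℝ (⊤ : ℕ∞) (fun y => (ρ y t)⁻¹ * pd i (fun y => pr y t) y) :=
      cri.mul (contDiff_pd cp)
    rw [hdt i, pd_sub' (dif ((cF i).sub c2)) (dif c3), pd_sub' (dif (cF i)) (dif c2),
      pd_sum' (fun j => dif (c1 j)), pd_mul' (dif cri) (dif (contDiff_pd cp))]
    congr 2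
    refine Finset.sum_congr rfl fun j _ => ?_
    rw [pd_mul' (dif (cu j)) (dif (contDiff_pd (cu i)))]
    rw [pd_comm' (cu i)]
  have hL : deriv (fun s => expR u x s) t
      = ∑ i, pd i (fun y => deriv (fun s => u y s i) t) x := by
    unfold expR
    exact (HasDerivAt.fun_sum fun i _ => swap_dt (hU i) x ht).deriv
  have hE : ∀ j, pd j (fun y => expR u y t) x = ∑ i, pd j (pd i (fun y => u y t i)) x := by
    intro j
    unfold expR
    exact pd_sum' (fun i => dif (contDiff_pd (cu i))) x
  rw [hL]
  simp only [key, hE, vort, eps, Fin.sum_univ_three]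
  norm_num
  ring
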